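/- For every formula φ ∈ L_{□,◇,∧,∨}[Prop] there exists a weak simulation duality (D⁺,D⁻) such that φ is true at every member of D⁺ and false at every member of D⁻; moreover the pointed models weakly simulating some member of D⁺ are exactly the pointed models of φ, and the pointed models weakly simulated by some member of D⁻ are exactly the pointed models refuting φ. -/

import Mathlib

/-- Modal formulas over propositional variables `α`, in negation normal form. -/
inductive MF (α : Type) : Type
  | top : MF α
  | bot : MF α
  | var : α → MF α
  | nvar : α → MF α
  | and : MF α → MF α → MF α
  | or : MF α → MF α → MF α
  | dia : MF α → MF α
  | box : MF α → MF α

/-- A pointed Kripke model over propositional variables `α`. -/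
structure PModel (α : Type) where
  World : Type
  Rel : World → World → Prop
  val : World → Set α
  pt : World

/-- Satisfaction of a modal formula at a world of a Kripke model. -/
def Sat {α : Type} (M : PModel α) : M.World → MF α → Prop
  | _, MF.top => True
  | _, MF.bot => False
  | w, MF.var p => p ∈ M.val w
  | w, MF.nvar p => p ∉ M.val w
  | w, MF.and φ ψ => Sat M w φ ∧ Sat M w ψ
  | w, MF.or φ ψ => Sat M w φ ∨ Sat M w ψ
  | w, MF.dia φ => ∃ u, M.Rel w u ∧ Sat M u φ
  | w, MF.box φ => ∀ u, M.Rel w u → Sat M u φ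

/-- Satisfaction at the distinguished point of a pointed model. -/
def PSat {α : Type} (M : PModel α) (φ : MF α) : Prop := Sat M M.pt φ

/-- Logical equivalence: satisfied by exactly the same pointed models. -/
def MFEquiv {α : Type} (φ ψ : MF α) : Prop := ∀ M : PModel α, PSat M φ ↔ PSat M ψ
/-- Repointing a pointed model at another of its worlds. -/
def PModel.repoint {α : Type} (M : PModel α) (w : M.World) : PModel α := { M with pt := w }

/-- `Z` is a bisimulation between the pointed models `M` and `M'`. -/
def IsBisim {α : Type} (M M' : PModel α) (Z : M.World → M'.World → Prop) : Prop :=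
  Z M.pt M'.pt ∧ ∀ t t', Z t t' →
    (M.val t = M'.val t') ∧
    (∀ u, M.Rel t u → ∃ u', M'.Rel t' u' ∧ Z u u') ∧
    (∀ u', M'.Rel t' u' → ∃ u, M.Rel t u ∧ Z u u')

/-- Two pointed models are bisimilar if some bisimulation relates them. -/
def Bisimilar {α : Type} (M M' : PModel α) : Prop := ∃ Z, IsBisim M M' Z

/-- The empty loopstate: a single reflexive world with empty colour. -/
def emptyLoop (α : Type) : PModel α := ⟨Unit, fun _ _ => True, fun _ => ∅, ()⟩

/-- The full loopstate: a single reflexive world whose colour is all of `Prop`. -/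
def fullLoop (α : Type) : PModel α := ⟨Unit, fun _ _ => True, fun _ => Set.univ, ()⟩

/-- `Z` is a weak simulation from the pointed model `M` to the pointed model `M'`. -/
def IsWeakSim {α : Type} (M M' : PModel α) (Z : M.World → M'.World → Prop) : Prop :=
  Z M.pt M'.pt ∧ ∀ t t', Z t t' →
    (M.val t ⊆ M'.val t') ∧
    (∀ u, M.Rel t u →
      Bisimilar (M.repoint u) (emptyLoop α) ∨ ∃ u', M'.Rel t' u' ∧ Z u u') ∧
    (∀ u', M'.Rel t' u' →
      Bisimilar (M'.repoint u') (fullLoop α) ∨ ∃ u, M.Rel t u ∧ Z u u')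

/-- `(M,s) ⇁ (M',s')`: some weak simulation from `M` to `M'` exists. -/
def WSim {α : Type} (M M' : PModel α) : Prop := ∃ Z, IsWeakSim M M' Z

/-- The fragment L_{□,◇,∧,∨}: formulas built from variables using only ∧, ∨, ◇, □. -/
inductive PosForm {α : Type} : MF α → Prop
  | var (p : α) : PosForm (MF.var p)
  | and {φ ψ : MF α} : PosForm φ → PosForm ψ → PosForm (MF.and φ ψ)
  | or {φ ψ : MF α} : PosForm φ → PosForm ψ → PosForm (MF.or φ ψ)
  | dia {φ : MF α} : PosForm φ → PosForm (MF.dia φ)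
  | box {φ : MF α} : PosForm φ → PosForm (MF.box φ)
/-- A weak simulation duality: a pair `(Dp, Dn)` of finite sets of finite pointed
models such that every pointed model either weakly simulates some member of `Dp`
or is weakly simulated by some member of `Dn`, and never both. -/
def WSimDuality {α : Type} (Dp Dn : Set (PModel α)) : Prop :=
  Dp.Finite ∧ Dn.Finite ∧
  (∀ M ∈ Dp, Finite M.World) ∧ (∀ M ∈ Dn, Finite M.World) ∧
  (∀ M : PModel α, (∃ E ∈ Dp, WSim E M) ↔ ¬ (∃ E ∈ Dn, WSim M E))
theorem PosForm.not_sat_of_isBisim_emptyLoop {α : Type} {φ : MF α} (hφ : PosForm φ)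
    {M : PModel α} {Z : M.World → (emptyLoop α).World → Prop} (hZ : IsBisim M (emptyLoop α) Z)
    (w : M.World) (hw : Z w ()) : ¬ Sat M w φ := by
  induction hφ generalizing w with
  | var p =>
    intro h
    have h' : p ∈ M.val w := h
    rw [(hZ.2 w () hw).1] at h'
    exact h'
  | and _ _ ihφ _ => exact fun h => ihφ w hw h.1
  | or _ _ ihφ ihψ => exact fun h => h.elim (ihφ w hw) (ihψ w hw)
  | dia _ ih =>
    rintro ⟨u, hu, hs⟩
    obtain ⟨_, _, hz⟩ := (hZ.2 w () hw).2.1 u hu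
    exact ih u hz hs
  | box _ ih =>
    intro h
    obtain ⟨u, hu, hz⟩ := (hZ.2 w () hw).2.2 () trivial
    exact ih u hz (h u hu)

theorem PosForm.sat_of_isBisim_fullLoop {α : Type} {φ : MF α} (hφ : PosForm φ)
    {M : PModel α} {Z : M.World → (fullLoop α).World → Prop} (hZ : IsBisim M (fullLoop α) Z)
    (w : M.World) (hw : Z w ()) : Sat M w φ := by
  induction hφ generalizing w with
  | var p =>
    change p ∈ M.val w
    rw [(hZ.2 w () hw).1]
    exact Set.mem_univ p
  | and _ _ ihφ ihψ => exact ⟨ihφ w hw, ihψ w hw⟩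
  | or _ _ ihφ _ => exact Or.inl (ihφ w hw)
  | dia _ ih =>
    obtain ⟨u, hu, hz⟩ := (hZ.2 w () hw).2.2 () trivial
    exact ⟨u, hu, ih u hz⟩
  | box _ ih =>
    intro u hu
    obtain ⟨_, _, hz⟩ := (hZ.2 w () hw).2.1 u hu
    exact ih u hz

theorem sat_repoint {α : Type} (M : PModel α) (v : M.World) (φ : MF α) (w : M.World) :
    Sat (M.repoint v) w φ ↔ Sat M w φ := by
  induction φ generalizing w with
  | top | bot | var | nvar => rfl
  | and φ ψ ihφ ihψ => exact and_congr (ihφ w) (ihψ w)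
  | or φ ψ ihφ ihψ => exact or_congr (ihφ w) (ihψ w)
  | dia φ ih => exact exists_congr fun u => and_congr Iff.rfl (ih u)
  | box φ ih => exact forall_congr' fun u => imp_congr Iff.rfl (ih u)

/-- Weak simulations preserve the formulas built from variables with `∧`, `∨`, `◇`, `□`. -/
theorem PosForm.sat_of_isWeakSim {α : Type} {φ : MF α} (hφ : PosForm φ) {M M' : PModel α}
    {Z : M.World → M'.World → Prop} (hZ : IsWeakSim M M' Z) (t : M.World) (t' : M'.World)
    (ht : Z t t') (h : Sat M t φ) : Sat M' t' φ := by
  induction hφ generalizing t t' with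
  | var p => exact (hZ.2 t t' ht).1 h
  | and _ _ ihφ ihψ => exact ⟨ihφ t t' ht h.1, ihψ t t' ht h.2⟩
  | or _ _ ihφ ihψ => exact h.imp (ihφ t t' ht) (ihψ t t' ht)
  | dia hψ ih =>
    obtain ⟨u, hu, hs⟩ := h
    obtain ⟨_, hB⟩ | ⟨u', hu', hz⟩ := (hZ.2 t t' ht).2.1 u hu
    · exact absurd ((sat_repoint M u _ u).2 hs) (hψ.not_sat_of_isBisim_emptyLoop hB u hB.1)
    · exact ⟨u', hu', ih u u' hz hs⟩
  | box hψ ih =>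
    intro u' hu'
    obtain ⟨_, hB⟩ | ⟨u, hu, hz⟩ := (hZ.2 t t' ht).2.2 u' hu'
    · exact (sat_repoint M' u' _ u').1 (hψ.sat_of_isBisim_fullLoop hB u' hB.1)
    · exact ih u u' hz (h u hu)

theorem PosForm.psat_of_wSim {α : Type} {φ : MF α} (hφ : PosForm φ) {M M' : PModel α}
    (hM : WSim M M') (h : PSat M φ) : PSat M' φ :=
  let ⟨_, hZ⟩ := hM
  hφ.sat_of_isWeakSim hZ M.pt M'.pt hZ.1 h

/-- Bisimulation types of depth `n`: a type of positive depth records a colour and the set of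
types of the successors, while depth `0` records nothing. -/
def BisimType (α : Type) : ℕ → Type
  | 0 => Unit
  | n + 1 => Set α × Set (BisimType α n)

instance BisimType.instFinite (α : Type) [Finite α] : ∀ n, Finite (BisimType α n)
  | 0 => inferInstanceAs (Finite Unit)
  | n + 1 =>
    have := BisimType.instFinite α n
    inferInstanceAs (Finite (Set α × Set (BisimType α n)))

/-- The depth-`n` bisimulation type of a world. -/
def bisimType {α : Type} (M : PModel α) : (n : ℕ) → M.World → BisimType α n
  | 0, _ => ()
  | n + 1, w => (M.val w, {t | ∃ u, M.Rel w u ∧ bisimType M n u = t})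

/-- The colour of a bisimulation type, with `S` used at depth `0`. -/
def BisimType.color {α : Type} (S : Set α) : (n : ℕ) → BisimType α n → Set α
  | 0, _ => S
  | _ + 1, x => x.1

/-- The successor relation on bisimulation types; the type of depth `0` is a loop. -/
def BisimType.Succ {α : Type} : (n : ℕ) → BisimType α n → (m : ℕ) → BisimType α m → Prop
  | 0, _, m, _ => m = 0
  | n + 1, x, m, y => ∃ t ∈ x.2, (⟨m, y⟩ : Σ k, BisimType α k) = ⟨n, t⟩

/-- The finite model of all bisimulation types of depth at most `n`, in which the type of depth
`0` is a loopstate of colour `S`, pointed at the type `t` of depth `n`. -/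
def typeModel {α : Type} (S : Set α) (n : ℕ) (t : BisimType α n) : PModel α where
  World := Σ k : Fin (n + 1), BisimType α k
  Rel a b := BisimType.Succ a.1 a.2 b.1 b.2
  val a := BisimType.color S a.1 a.2
  pt := ⟨Fin.last n, t⟩

/-- Modal depth. -/
def MF.depth {α : Type} : MF α → ℕ
  | MF.top | MF.bot | MF.var _ | MF.nvar _ => 0
  | MF.and φ ψ | MF.or φ ψ => max φ.depth ψ.depth
  | MF.dia φ | MF.box φ => φ.depth + 1

theorem typeModel_rel_bisimType {α : Type} (S : Set α) {n : ℕ} (t : BisimType α n)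
    (M : PModel α) (w : M.World) {k : ℕ} (hk : k + 1 < n + 1) (b : (typeModel S n t).World) :
    (typeModel S n t).Rel ⟨⟨k + 1, hk⟩, bisimType M (k + 1) w⟩ b ↔
      ∃ u, M.Rel w u ∧ b = ⟨⟨k, by omega⟩, bisimType M k u⟩ := by
  obtain ⟨⟨m, hm⟩, y⟩ := b
  constructor
  · rintro ⟨_, ⟨u, hu, rfl⟩, h⟩
    obtain ⟨rfl, h⟩ := Sigma.mk.inj h
    exact ⟨u, hu, Sigma.ext rfl h⟩
  · rintro ⟨u, hu, h⟩
    cases h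
    exact ⟨_, ⟨u, hu, rfl⟩, rfl⟩

theorem sat_typeModel_bisimType {α : Type} (S : Set α) {n : ℕ} (t : BisimType α n)
    (M : PModel α) (φ : MF α) (w : M.World) {k : ℕ} (hk : k < n + 1) (hφ : φ.depth < k) :
    Sat (typeModel S n t) ⟨⟨k, hk⟩, bisimType M k w⟩ φ ↔ Sat M w φ := by
  induction φ generalizing w k with
  | top | bot => rfl
  | var p | nvar p =>
    cases k with
    | zero => omega
    | succ k => rfl
  | and φ ψ ihφ ihψ =>
    rw [MF.depth, max_lt_iff] at hφ
    exact and_congr (ihφ w hk hφ.1) (ihψ w hk hφ.2)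
  | or φ ψ ihφ ihψ =>
    rw [MF.depth, max_lt_iff] at hφ
    exact or_congr (ihφ w hk hφ.1) (ihψ w hk hφ.2)
  | dia φ ih =>
    cases k with
    | zero => omega
    | succ k =>
      have hφ' : φ.depth < k := Nat.lt_of_succ_lt_succ hφ
      simp only [Sat, typeModel_rel_bisimType]
      constructor
      · rintro ⟨_, ⟨u, hu, rfl⟩, hs⟩
        exact ⟨u, hu, (ih u _ hφ').1 hs⟩
      · rintro ⟨u, hu, hs⟩
        exact ⟨_, ⟨u, hu, rfl⟩, (ih u _ hφ').2 hs⟩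
  | box φ ih =>
    cases k with
    | zero => omega
    | succ k =>
      have hφ' : φ.depth < k := Nat.lt_of_succ_lt_succ hφ
      simp only [Sat, typeModel_rel_bisimType]
      constructor
      · intro h u hu
        exact (ih u _ hφ').1 (h _ ⟨u, hu, rfl⟩)
      · rintro h _ ⟨u, hu, rfl⟩
        exact (ih u _ hφ').2 (h u hu)

theorem bisimilar_loop_of_depth_eq_zero {α : Type} (S : Set α) {n : ℕ} (t : BisimType α n)
    (a : (typeModel S n t).World) (ha : a.1.val = 0) :
    Bisimilar ((typeModel S n t).repoint a) ⟨Unit, fun _ _ => True, fun _ => S, ()⟩ := by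
  refine ⟨fun b _ => b.1.val = 0, ha, ?_⟩
  rintro ⟨⟨m, hm⟩, y⟩ _ hb
  obtain rfl : m = 0 := hb
  exact ⟨rfl, fun u hu => ⟨(), trivial, hu⟩, fun _ _ => ⟨⟨⟨0, hm⟩, y⟩, rfl, rfl⟩⟩

theorem typeModel_empty_wSim {α : Type} (M : PModel α) (n : ℕ) :
    WSim (typeModel ∅ n (bisimType M n M.pt)) M := by
  refine ⟨fun a w => a.2 = bisimType M a.1 w, rfl, ?_⟩
  rintro ⟨⟨k, hk⟩, x⟩ w hx
  obtain rfl : x = bisimType M k w := hx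
  cases k with
  | zero =>
    exact ⟨Set.empty_subset _,
      fun u hu => Or.inl (bisimilar_loop_of_depth_eq_zero ∅ _ u hu),
      fun u' _ => Or.inr ⟨⟨⟨0, hk⟩, ()⟩, rfl, rfl⟩⟩
  | succ k =>
    refine ⟨subset_rfl, fun u hu => Or.inr ?_, fun u' hu' => Or.inr ?_⟩
    · obtain ⟨u', hu', rfl⟩ := (typeModel_rel_bisimType _ _ M w hk u).1 hu
      exact ⟨u', hu', rfl⟩
    · exact ⟨_, (typeModel_rel_bisimType _ _ M w hk _).2 ⟨u', hu', rfl⟩, rfl⟩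

theorem wSim_typeModel_univ {α : Type} (M : PModel α) (n : ℕ) :
    WSim M (typeModel Set.univ n (bisimType M n M.pt)) := by
  refine ⟨fun w a => a.2 = bisimType M a.1 w, rfl, ?_⟩
  rintro w ⟨⟨k, hk⟩, x⟩ hx
  obtain rfl : x = bisimType M k w := hx
  cases k with
  | zero =>
    exact ⟨Set.subset_univ _,
      fun u _ => Or.inr ⟨⟨⟨0, hk⟩, ()⟩, rfl, rfl⟩,
      fun u' hu' => Or.inl (bisimilar_loop_of_depth_eq_zero Set.univ _ u' hu')⟩
  | succ k =>
    refine ⟨subset_rfl, fun u hu => Or.inr ?_, fun u' hu' => Or.inr ?_⟩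
    · exact ⟨_, (typeModel_rel_bisimType _ _ M w hk _).2 ⟨u, hu, rfl⟩, rfl⟩
    · obtain ⟨u, hu, rfl⟩ := (typeModel_rel_bisimType _ _ M w hk u').1 hu'
      exact ⟨u, hu, rfl⟩

theorem psat_typeModel_bisimType {α : Type} (S : Set α) (M : PModel α) (φ : MF α) :
    PSat (typeModel S (φ.depth + 1) (bisimType M (φ.depth + 1) M.pt)) φ ↔ PSat M φ :=
  sat_typeModel_bisimType S _ M φ M.pt _ (Nat.lt_succ_self _)

/-- every formula `φ ∈ L_{□,◇,∧,∨}[Prop]` fits some weak simulation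
duality `(Dp, Dn)`; moreover the pointed models weakly simulating some member of
`Dp` are exactly the models of `φ`, and the pointed models weakly simulated by
some member of `Dn` are exactly the pointed models refuting `φ`. -/
theorem exists_duality_for_posForm {α : Type} [Fintype α] (φ : MF α) (hφ : PosForm φ) :
    ∃ Dp Dn : Set (PModel α), WSimDuality Dp Dn ∧
      (∀ M ∈ Dp, PSat M φ) ∧ (∀ M ∈ Dn, ¬ PSat M φ) ∧
      (∀ M : PModel α, (∃ E ∈ Dp, WSim E M) ↔ PSat M φ) ∧
      (∀ M : PModel α, (∃ E ∈ Dn, WSim M E) ↔ ¬ PSat M φ) := by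
  have hp : ∀ M : PModel α,
      (∃ E ∈ {E ∈ Set.range (typeModel ∅ (φ.depth + 1)) | PSat E φ}, WSim E M) ↔ PSat M φ :=
    fun M => ⟨fun ⟨_, hE, hM⟩ => hφ.psat_of_wSim hM hE.2, fun h =>
      ⟨_, ⟨⟨_, rfl⟩, (psat_typeModel_bisimType ∅ M φ).2 h⟩, typeModel_empty_wSim M _⟩⟩
  have hn : ∀ M : PModel α,
      (∃ E ∈ {E ∈ Set.range (typeModel Set.univ (φ.depth + 1)) | ¬ PSat E φ}, WSim M E) ↔
        ¬ PSat M φ :=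
    fun M => ⟨fun ⟨_, hE, hM⟩ h => hE.2 (hφ.psat_of_wSim hM h), fun h =>
      ⟨_, ⟨⟨_, rfl⟩, mt (psat_typeModel_bisimType Set.univ M φ).1 h⟩, wSim_typeModel_univ M _⟩⟩
  have hfin : ∀ (S : Set α) (n : ℕ) (t : BisimType α n), Finite (typeModel S n t).World :=
    fun S n t => inferInstanceAs (Finite (Σ k : Fin (n + 1), BisimType α k))
  refine ⟨_, _, ⟨(Set.finite_range _).sep _, (Set.finite_range _).sep _, ?_, ?_, fun M => ?_⟩,
    fun _ hM => hM.2, fun _ hM => hM.2, hp, hn⟩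
  · rintro _ ⟨⟨t, rfl⟩, _⟩
    exact hfin _ _ t
  · rintro _ ⟨⟨t, rfl⟩, _⟩
    exact hfin _ _ t
  · rw [hp, hn, not_not]
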